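/- (Appendix, Han-inequality step (31)) Let d ≥ 2, n = d+1, ℓ ∈ [1:d−1], and ℓ₁ ∈ [0:⌊ℓ/2⌋]. For any symmetrical code that satisfies node regeneration, and for any subset τ ⊆ [ℓ+2:d+1] with |τ| = r where r ∈ [1:d−ℓ], one has H(S_{τ→ℓ+1} | W_{[ℓ₁+1:2ℓ₁]}, S_{ℓ+1→[ℓ₁+1:2ℓ₁]}, M^{(ℓ)}) ≥ (r/(d−ℓ)) · ( H(U^{(ℓ₁,ℓ+1)} | M^{(ℓ)}) − H(U^{(ℓ₁,ℓ)} | M^{(ℓ)}) ). -/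

import Mathlib

open scoped BigOperators Classical

namespace MDCSR

noncomputable section

/-- `X` is a deterministic function of `Y`. -/
def IsFuncOf {Ω α β : Type*} (X : Ω → α) (Y : Ω → β) : Prop :=
  ∃ f : β → α, ∀ ω, X ω = f (Y ω)

variable {Ω V : Type} [Fintype Ω]

/-- Probability of the event `X = x` under the probability mass function `p`. -/
def pm (p : Ω → ℝ) {α : Type*} (X : Ω → α) (x : α) : ℝ :=
  ∑ ω ∈ Finset.univ.filter (fun ω' => X ω' = x), p ω

/-- Shannon entropy of the random variable `X` under the probability mass function `p`. -/
def H (p : Ω → ℝ) {α : Type*} (X : Ω → α) : ℝ :=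
  -∑ ω, p ω * Real.log (pm p X (X ω))

/-- An `(n = d+1, d)` code: messages `M 1, …, M d`, a key `K`, node contents
`W 1, …, W (d+1)`, and repair data `S i j` (data downloaded from node `i` to repair
node `j`), all random variables on a common finite probability space `(Ω, p)`.
The messages are mutually independent, the key is independent of the messages,
each `W i` is a deterministic function of the messages and the key, and each
`S i j` is a deterministic function of `W i`. -/
structure Code (Ω V : Type) [Fintype Ω] (d : ℕ) : Type where
  p : Ω → ℝ
  p_nonneg : ∀ ω, 0 ≤ p ω
  p_sum : ∑ ω, p ω = 1
  M : ℕ → Ω → V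
  K : Ω → V
  W : ℕ → Ω → V
  S : ℕ → ℕ → Ω → V
  M_indep : ∀ x : ℕ → V,
    pm p (fun ω (i : Fin d) => M (↑i + 1) ω) (fun i => x (↑i + 1)) =
      ∏ i ∈ Finset.Icc 1 d, pm p (M i) (x i)
  K_indep : ∀ (k : V) (x : ℕ → V),
    pm p (fun ω => (K ω, fun (i : Fin d) => M (↑i + 1) ω)) (k, fun i => x (↑i + 1)) =
      pm p K k * pm p (fun ω (i : Fin d) => M (↑i + 1) ω) (fun i => x (↑i + 1))
  W_func : ∀ i ∈ Finset.Icc 1 (d + 1),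
    IsFuncOf (W i) (fun ω => ((fun (j : Fin d) => M (↑j + 1) ω), K ω))
  S_func : ∀ i ∈ Finset.Icc 1 (d + 1), ∀ j ∈ Finset.Icc 1 (d + 1), i ≠ j →
    IsFuncOf (S i j) (W i)

/-- Descriptors for the basic random variables of a code. -/
inductive Atom where
  | M : ℕ → Atom
  | K : Atom
  | W : ℕ → Atom
  | S : ℕ → ℕ → Atom

variable {d : ℕ}

/-- The random variable described by an atom. -/
def Code.atomRV (C : Code Ω V d) : Atom → Ω → V
  | .M i => C.M i
  | .K => C.K
  | .W i => C.W i
  | .S i j => C.S i j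

/-- The joint random variable (tuple) described by a list of atoms. -/
def Code.rv (C : Code Ω V d) (L : List Atom) : Ω → List V :=
  fun ω => L.map fun a => C.atomRV a ω

/-- Joint entropy of a tuple of basic random variables. -/
def Code.HL (C : Code Ω V d) (L : List Atom) : ℝ := H C.p (C.rv L)

/-- Conditional entropy `H(L₁ | L₂)`. -/
def Code.CH (C : Code Ω V d) (L₁ L₂ : List Atom) : ℝ := C.HL (L₁ ++ L₂) - C.HL L₂

/-- Mutual information `I(L₁ ; L₂)`. -/
def Code.MI (C : Code Ω V d) (L₁ L₂ : List Atom) : ℝ :=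
  C.HL L₁ + C.HL L₂ - C.HL (L₁ ++ L₂)

/-- Relabeling of an atom along a permutation of the storage-node indices. -/
def Atom.perm (π : Equiv.Perm ℕ) : Atom → Atom
  | .M i => .M i
  | .K => .K
  | .W i => .W (π i)
  | .S i j => .S (π i) (π j)

/-- A code is symmetrical if every joint entropy of a tuple of the basic random
variables is invariant under every permutation of the storage-node indices `[1:n]`. -/
def Code.Symmetrical (C : Code Ω V d) : Prop :=
  ∀ π : Equiv.Perm ℕ, (∀ i ∈ Finset.Icc 1 (d + 1), π i ∈ Finset.Icc 1 (d + 1)) →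
    ∀ L : List Atom, C.HL (L.map (Atom.perm π)) = C.HL L

/-- The list `[a, a+1, …, b]`. -/
def icc (a b : ℕ) : List ℕ := List.range' a (b + 1 - a)

/-- `W_A` as a list of atoms. -/
def Ws (A : List ℕ) : List Atom := A.map Atom.W

/-- `M_A` as a list of atoms. -/
def MsL (A : List ℕ) : List Atom := A.map Atom.M

/-- `M^{(m)} = (M_1, …, M_m)`. -/
def Mup (m : ℕ) : List Atom := MsL (icc 1 m)

/-- `S_{B → j}`. -/
def Sto (B : List ℕ) (j : ℕ) : List Atom := B.map fun i => Atom.S i j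

/-- `S_{i → B}`. -/
def Sfrom (i : ℕ) (B : List ℕ) : List Atom := B.map fun j => Atom.S i j

/-- `S̄_{→ j} = S_{[j+1:n] → j}` (here `n = d+1`). -/
def SbarTo (d j : ℕ) : List Atom := Sto (icc (j + 1) (d + 1)) j

/-- `S̄_{→ A}`. -/
def SbarToL (d : ℕ) (A : List ℕ) : List Atom := (A.map (SbarTo d)).flatten

/-- `S̲_{→ j} = S_{[1:j-1] → j}`. -/
def SunderTo (j : ℕ) : List Atom := Sto (icc 1 (j - 1)) j

/-- `S̲_{→ A}`. -/
def SunderToL (A : List ℕ) : List Atom := (A.map SunderTo).flatten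

/-- `S_{→ j} = S_{([1:n] ∖ {j}) → j}` (here `n = d+1`). -/
def StoFull (d j : ℕ) : List Atom := Sto ((icc 1 (d + 1)).filter (fun i => i ≠ j)) j

/-- `(S_{→ j} : j ∈ A)`. -/
def StoFullL (d : ℕ) (A : List ℕ) : List Atom := (A.map (StoFull d)).flatten

/-- `U^{(t,s)} = (W_{[1:t]}, S̄_{→[t+1:s]})`. -/
def U (d t s : ℕ) : List Atom := Ws (icc 1 t) ++ SbarToL d (icc (t + 1) s)

/-- Node regeneration: each `W j` is a deterministic function of `S_{→ j}`. -/
def Code.NodeRegen (C : Code Ω V d) : Prop :=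
  ∀ j ∈ Finset.Icc 1 (d + 1), IsFuncOf (C.W j) (C.rv (StoFull d j))

/-- Message recovery for parameter `ℓ`: `M j` is constant for `j ∈ [1:ℓ]`, and for every
`A ⊆ [1:n]` with `|A| ∈ [ℓ+1:d]`, `M_{|A|}` is a deterministic function of `W_A`. -/
def Code.MsgRecovery (C : Code Ω V d) (ℓ : ℕ) : Prop :=
  (∀ j ∈ Finset.Icc 1 ℓ, ∃ c : V, ∀ ω, C.M j ω = c) ∧
  ∀ A : Finset ℕ, A ⊆ Finset.Icc 1 (d + 1) → A.card ∈ Finset.Icc (ℓ + 1) d →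
    IsFuncOf (C.M A.card) (C.rv (Ws (A.sort (· ≤ ·))))

/-- Repair secrecy for parameters `ℓ₁, ℓ₂`: for all disjoint `E₁, E₂ ⊆ [1:n]` with
`|E₁| = ℓ₁`, `|E₂| = ℓ₂`, the messages `M_{ℓ+1}, …, M_d` are independent of
`((W_i : i ∈ E₁), (S_{→j} : j ∈ E₂))`, where `ℓ = ℓ₁ + ℓ₂`. -/
def Code.RepairSecrecy (C : Code Ω V d) (ℓ₁ ℓ₂ : ℕ) : Prop :=
  ∀ E₁ E₂ : Finset ℕ, E₁ ⊆ Finset.Icc 1 (d + 1) → E₂ ⊆ Finset.Icc 1 (d + 1) →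
    Disjoint E₁ E₂ → E₁.card = ℓ₁ → E₂.card = ℓ₂ →
    C.MI (MsL (icc (ℓ₁ + ℓ₂ + 1) d))
      (Ws (E₁.sort (· ≤ ·)) ++ StoFullL d (E₂.sort (· ≤ ·))) = 0

/-- `T_{d,k,ℓ} = Σ_{t=ℓ+1}^{k} (d+1−t)`, as a real number. -/
def T (d k ℓ : ℕ) : ℝ := ∑ t ∈ Finset.Icc (ℓ + 1) k, ((d : ℝ) + 1 - (t : ℝ))


section Entropy

/-- `X` is determined by `Y` pointwise: outcomes that agree on `Y` agree on `X`. -/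
def DeterminedBy {Ω α β : Type*} (X : Ω → α) (Y : Ω → β) : Prop :=
  ∀ ω ω', Y ω = Y ω' → X ω = X ω'

theorem IsFuncOf.determinedBy {Ω α β : Type*} {X : Ω → α} {Y : Ω → β} (h : IsFuncOf X Y) :
    DeterminedBy X Y := by
  obtain ⟨f, hf⟩ := h
  intro ω ω' e
  rw [hf, hf, e]

theorem pm_self_nonneg {Ω : Type} [Fintype Ω] {p : Ω → ℝ} (hp : ∀ ω, 0 ≤ p ω) {α : Type*}
    (X : Ω → α) (x : α) : 0 ≤ pm p X x :=
  Finset.sum_nonneg fun ω _ => hp ω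

theorem le_pm_self {Ω : Type} [Fintype Ω] {p : Ω → ℝ} (hp : ∀ ω, 0 ≤ p ω) {α : Type*}
    (X : Ω → α) (ω : Ω) : p ω ≤ pm p X (X ω) :=
  Finset.single_le_sum (f := p) (fun ω' _ => hp ω') (by simp)

theorem pm_le_pm_of_determinedBy {Ω : Type} [Fintype Ω] {p : Ω → ℝ} (hp : ∀ ω, 0 ≤ p ω)
    {α β : Type*} {X : Ω → α} {Y : Ω → β} (h : DeterminedBy X Y) (ω : Ω) :
    pm p Y (Y ω) ≤ pm p X (X ω) := by
  refine Finset.sum_le_sum_of_subset_of_nonneg ?_ fun ω' _ _ => hp ω'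
  intro ω' hω'
  simp only [Finset.mem_filter, Finset.mem_univ, true_and] at hω' ⊢
  exact h _ _ hω'

theorem H_le_of_determinedBy {Ω : Type} [Fintype Ω] {p : Ω → ℝ} (hp : ∀ ω, 0 ≤ p ω)
    {α β : Type*} {X : Ω → α} {Y : Ω → β} (h : DeterminedBy X Y) : H p X ≤ H p Y := by
  refine neg_le_neg (Finset.sum_le_sum fun ω _ => ?_)
  rcases (hp ω).eq_or_lt with h0 | h0
  · simp [← h0]
  · exact mul_le_mul_of_nonneg_left
      (Real.log_le_log (h0.trans_le (le_pm_self hp Y ω)) (pm_le_pm_of_determinedBy hp h ω)) h0.le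

theorem sum_mul_ite_eq_pm {Ω : Type} [Fintype Ω] (p : Ω → ℝ) {α : Type*} (X : Ω → α) (x : α) :
    ∑ ω, (if X ω = x then p ω else 0) = pm p X x := by
  rw [pm, Finset.sum_filter]

/-- The total mass of the conditionally independent coupling of `X` and `Y` given `Z`, restricted
to the support of the joint variable `W`, is at most one. -/
theorem sum_mul_pm_div_le_one {Ω : Type} [Fintype Ω] {p : Ω → ℝ} (hp : ∀ ω, 0 ≤ p ω)
    (hsum : ∑ ω, p ω = 1) {α β γ δ : Type*} {X : Ω → α} {Y : Ω → β} {Z : Ω → γ} {W : Ω → δ}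
    (hZX : DeterminedBy Z X) (hZY : DeterminedBy Z Y)
    (hW : ∀ ω ω', X ω = X ω' → Y ω = Y ω' → W ω = W ω') :
    ∑ ω, p ω * (pm p X (X ω) * pm p Y (Y ω) / (pm p W (W ω) * pm p Z (Z ω))) ≤ 1 := by
  have inner : ∀ ω₁ ω₂,
      ∑ ω, p ω * ((if X ω₁ = X ω then p ω₁ else 0) * (if Y ω₂ = Y ω then p ω₂ else 0)
        / (pm p W (W ω) * pm p Z (Z ω)))
      ≤ p ω₁ / pm p Z (Z ω₁) * (if Z ω₂ = Z ω₁ then p ω₂ else 0) := by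
    intro ω₁ ω₂
    have hc : 0 ≤ p ω₁ / pm p Z (Z ω₁) * (if Z ω₂ = Z ω₁ then p ω₂ else 0) := by
      refine mul_nonneg (div_nonneg (hp _) (pm_self_nonneg hp _ _)) ?_
      split_ifs
      · exact hp _
      · exact le_rfl
    by_cases hex : ∃ ω₀, X ω₁ = X ω₀ ∧ Y ω₂ = Y ω₀
    · obtain ⟨ω₀, hX₀, hY₀⟩ := hex
      have hZ₁ : Z ω₁ = Z ω₀ := hZX _ _ hX₀
      have hZ₂ : Z ω₂ = Z ω₀ := hZY _ _ hY₀
      have hle : ∀ ω, p ω * ((if X ω₁ = X ω then p ω₁ else 0) *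
          (if Y ω₂ = Y ω then p ω₂ else 0) / (pm p W (W ω) * pm p Z (Z ω)))
          ≤ (if W ω = W ω₀ then p ω else 0) *
            (p ω₁ / pm p Z (Z ω₁) * p ω₂ / pm p W (W ω₀)) := by
        intro ω
        by_cases hX : X ω₁ = X ω
        · by_cases hY : Y ω₂ = Y ω
          · have hWω : W ω = W ω₀ := hW _ _ (hX.symm.trans hX₀) (hY.symm.trans hY₀)
            rw [if_pos hX, if_pos hY, if_pos hWω, hWω, hZX _ _ hX]
            apply le_of_eq
            rw [div_eq_mul_inv, div_eq_mul_inv, div_eq_mul_inv, mul_inv]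
            ring
          · rw [if_neg hY, mul_zero, zero_div, mul_zero]
            refine mul_nonneg ?_ (div_nonneg (mul_nonneg (div_nonneg (hp _)
              (pm_self_nonneg hp _ _)) (hp _)) (pm_self_nonneg hp _ _))
            split_ifs
            · exact hp _
            · exact le_rfl
        · rw [if_neg hX, zero_mul, zero_div, mul_zero]
          refine mul_nonneg ?_ (div_nonneg (mul_nonneg (div_nonneg (hp _)
            (pm_self_nonneg hp _ _)) (hp _)) (pm_self_nonneg hp _ _))
          split_ifs
          · exact hp _
          · exact le_rfl
      refine (Finset.sum_le_sum fun ω _ => hle ω).trans ?_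
      rw [← Finset.sum_mul, sum_mul_ite_eq_pm, if_pos (hZ₂.trans hZ₁.symm), mul_div_assoc',
        mul_comm (pm p W (W ω₀)), mul_div_assoc]
      exact mul_le_of_le_one_right (mul_nonneg (div_nonneg (hp _)
        (pm_self_nonneg hp _ _)) (hp _)) (div_self_le_one _)
    · refine le_trans (le_of_eq (Finset.sum_eq_zero fun ω _ => ?_)) hc
      by_cases hX : X ω₁ = X ω
      · have hY : ¬ Y ω₂ = Y ω := fun hY => hex ⟨ω, hX, hY⟩
        simp [hY]
      · simp [hX]
  calc ∑ ω, p ω * (pm p X (X ω) * pm p Y (Y ω) / (pm p W (W ω) * pm p Z (Z ω)))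
      = ∑ ω₁, ∑ ω₂, ∑ ω, p ω * ((if X ω₁ = X ω then p ω₁ else 0) *
          (if Y ω₂ = Y ω then p ω₂ else 0) / (pm p W (W ω) * pm p Z (Z ω))) := by
        rw [Finset.sum_congr rfl fun ω₁ _ => Finset.sum_comm, Finset.sum_comm]
        refine Finset.sum_congr rfl fun ω _ => ?_
        simp_rw [← Finset.mul_sum, ← Finset.sum_div, ← Finset.mul_sum, ← Finset.sum_mul,
          sum_mul_ite_eq_pm]
    _ ≤ ∑ ω₁, ∑ ω₂, p ω₁ / pm p Z (Z ω₁) * (if Z ω₂ = Z ω₁ then p ω₂ else 0) :=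
        Finset.sum_le_sum fun ω₁ _ => Finset.sum_le_sum fun ω₂ _ => inner ω₁ ω₂
    _ = ∑ ω₁, p ω₁ * (pm p Z (Z ω₁) / pm p Z (Z ω₁)) := by
        refine Finset.sum_congr rfl fun ω₁ _ => ?_
        rw [← Finset.mul_sum, sum_mul_ite_eq_pm]
        ring
    _ ≤ ∑ ω₁, p ω₁ :=
        Finset.sum_le_sum fun ω₁ _ => mul_le_of_le_one_right (hp _) (div_self_le_one _)
    _ = 1 := hsum

/-- Submodularity of entropy. -/
theorem H_submodular {Ω : Type} [Fintype Ω] {p : Ω → ℝ} (hp : ∀ ω, 0 ≤ p ω)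
    (hsum : ∑ ω, p ω = 1) {α β γ δ : Type*} {X : Ω → α} {Y : Ω → β} {Z : Ω → γ} {W : Ω → δ}
    (hZX : DeterminedBy Z X) (hZY : DeterminedBy Z Y)
    (hW : ∀ ω ω', X ω = X ω' → Y ω = Y ω' → W ω = W ω') :
    H p W + H p Z ≤ H p X + H p Y := by
  have key : ∀ ω, p ω * (1 - pm p X (X ω) * pm p Y (Y ω) / (pm p W (W ω) * pm p Z (Z ω))) ≤
      p ω * Real.log (pm p W (W ω)) + p ω * Real.log (pm p Z (Z ω))
        - p ω * Real.log (pm p X (X ω)) - p ω * Real.log (pm p Y (Y ω)) := by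
    intro ω
    rcases (hp ω).eq_or_lt with h0 | h0
    · simp [← h0]
    have hx := h0.trans_le (le_pm_self hp X ω)
    have hy := h0.trans_le (le_pm_self hp Y ω)
    have hz := h0.trans_le (le_pm_self hp Z ω)
    have hw := h0.trans_le (le_pm_self hp W ω)
    have hlog := Real.log_le_sub_one_of_pos (div_pos (mul_pos hx hy) (mul_pos hw hz))
    rw [Real.log_div (mul_pos hx hy).ne' (mul_pos hw hz).ne', Real.log_mul hx.ne' hy.ne',
      Real.log_mul hw.ne' hz.ne'] at hlog
    rw [← mul_add, ← mul_sub, ← mul_sub]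
    exact mul_le_mul_of_nonneg_left (by linarith) h0.le
  have hkey := Finset.sum_le_sum (s := Finset.univ) fun ω _ => key ω
  have hone := sum_mul_pm_div_le_one hp hsum hZX hZY hW
  simp only [mul_sub, mul_one, Finset.sum_sub_distrib, Finset.sum_add_distrib] at hkey
  simp only [H]
  linarith

end Entropy

section Concave

/-- A real sequence that is concave on `[0, m]` has secant slopes from `0` that decrease. -/
theorem mul_sub_le_mul_sub_of_concave {g : ℕ → ℝ} {m : ℕ}
    (hg : ∀ k, k + 2 ≤ m → g (k + 2) + g k ≤ 2 * g (k + 1)) {r : ℕ} (hr : 1 ≤ r) (hrm : r ≤ m) :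
    (r : ℝ) * (g m - g 0) ≤ m * (g r - g 0) := by
  have slope : ∀ k, k + 1 ≤ m → (k : ℝ) * (g (k + 1) - g k) ≤ g k - g 0 := by
    intro k
    induction k with
    | zero => intro _; simp
    | succ k ih =>
      intro hk
      have h1 := ih (by omega)
      have h2 := hg k (by omega)
      have h3 : ((k : ℝ) + 1) * (g (k + 2) - g (k + 1)) ≤ (k + 1) * (g (k + 1) - g k) :=
        mul_le_mul_of_nonneg_left (by linarith) (by positivity)
      push_cast
      linarith
  have main : ∀ j, r ≤ j → j ≤ m → (r : ℝ) * (g j - g 0) ≤ j * (g r - g 0) := by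
    intro j hj
    induction j, hj using Nat.le_induction with
    | base => intro _; exact le_rfl
    | succ j hj ih =>
      intro hjm
      have h1 := ih (by omega)
      have h2 := slope j hjm
      have hj0 : (0 : ℝ) < j := by exact_mod_cast (by omega : 0 < j)
      have h3 := mul_le_mul_of_nonneg_left h2 (Nat.cast_nonneg (α := ℝ) r)
      have h4 := mul_le_mul_of_nonneg_left h1 (by positivity : (0 : ℝ) ≤ (j : ℝ) + 1)
      push_cast
      refine le_of_mul_le_mul_left ?_ hj0
      linarith
  exact main m hrm le_rfl

end Concave

section Code

variable {Ω V : Type} [Fintype Ω] {d : ℕ}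

theorem mem_icc {a b x : ℕ} : x ∈ icc a b ↔ a ≤ x ∧ x ≤ b := by
  rw [icc, List.mem_range'_1]
  omega

theorem mem_Ws {A : List ℕ} {a : Atom} : a ∈ Ws A ↔ ∃ i ∈ A, Atom.W i = a := List.mem_map

theorem mem_Mup {m : ℕ} {a : Atom} : a ∈ Mup m ↔ ∃ i ∈ icc 1 m, Atom.M i = a := List.mem_map

theorem mem_Sto {A : List ℕ} {j : ℕ} {a : Atom} : a ∈ Sto A j ↔ ∃ i ∈ A, Atom.S i j = a :=
  List.mem_map

theorem mem_Sfrom {A : List ℕ} {i : ℕ} {a : Atom} : a ∈ Sfrom i A ↔ ∃ j ∈ A, Atom.S i j = a :=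
  List.mem_map

theorem mem_SbarToL {A : List ℕ} {a : Atom} :
    a ∈ SbarToL d A ↔ ∃ j ∈ A, ∃ i ∈ icc (j + 1) (d + 1), Atom.S i j = a := by
  simp only [SbarToL, List.mem_flatten, List.mem_map, SbarTo, exists_exists_and_eq_and, mem_Sto]

theorem Code.rv_eq_rv_iff (C : Code Ω V d) {L : List Atom} {ω ω' : Ω} :
    C.rv L ω = C.rv L ω' ↔ ∀ a ∈ L, C.atomRV a ω = C.atomRV a ω' :=
  List.map_inj_left

theorem Code.determinedBy_of_subset (C : Code Ω V d) {L L' : List Atom} (h : L ⊆ L') :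
    DeterminedBy (C.rv L) (C.rv L') := fun _ _ e =>
  C.rv_eq_rv_iff.2 fun a ha => C.rv_eq_rv_iff.1 e a (h ha)

theorem Code.HL_congr (C : Code Ω V d) {L L' : List Atom} (h : ∀ a, a ∈ L ↔ a ∈ L') :
    C.HL L = C.HL L' :=
  le_antisymm
    (H_le_of_determinedBy C.p_nonneg (C.determinedBy_of_subset fun a => (h a).1))
    (H_le_of_determinedBy C.p_nonneg (C.determinedBy_of_subset fun a => (h a).2))

theorem Code.HL_submodular (C : Code Ω V d) {X Y Z W : List Atom}
    (hZX : DeterminedBy (C.rv Z) (C.rv X)) (hZY : DeterminedBy (C.rv Z) (C.rv Y))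
    (hW : W ⊆ X ++ Y) : C.HL W + C.HL Z ≤ C.HL X + C.HL Y := by
  refine H_submodular C.p_nonneg C.p_sum hZX hZY fun ω ω' hX hY => C.rv_eq_rv_iff.2 fun a ha => ?_
  rcases List.mem_append.1 (hW ha) with h | h
  · exact C.rv_eq_rv_iff.1 hX a h
  · exact C.rv_eq_rv_iff.1 hY a h

/-- The repair data `U^{(t,s)}` determines the contents of the nodes `1, …, s`. -/
theorem Code.W_determinedBy_U (C : Code Ω V d) (hregen : C.NodeRegen) {t s : ℕ} (hs : s ≤ d + 1)
    {j : ℕ} (hj : 1 ≤ j) (hjs : j ≤ s) : DeterminedBy (C.W j) (C.rv (U d t s)) := by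
  intro ω ω' e
  rw [C.rv_eq_rv_iff] at e
  induction j using Nat.strong_induction_on with
  | _ j ih =>
    by_cases hjt : j ≤ t
    · exact e (.W j) (List.mem_append_left _ (mem_Ws.2 ⟨j, mem_icc.2 ⟨hj, hjt⟩, rfl⟩))
    have hjmem : j ∈ Finset.Icc 1 (d + 1) := Finset.mem_Icc.2 ⟨hj, by omega⟩
    refine (hregen j hjmem).determinedBy _ _ (C.rv_eq_rv_iff.2 fun a ha => ?_)
    obtain ⟨i, hi, rfl⟩ := mem_Sto.1 ha
    obtain ⟨hi, hij⟩ := List.mem_filter.1 hi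
    rw [mem_icc] at hi
    have hij : i ≠ j := by simpa using hij
    rcases lt_or_gt_of_ne hij with h | h
    · exact (C.S_func i (Finset.mem_Icc.2 hi) j hjmem hij).determinedBy _ _
        (ih i h hi.1 (by omega))
    · exact e (.S i j) (List.mem_append_right _ (mem_SbarToL.2
        ⟨j, mem_icc.2 ⟨by omega, hjs⟩, i, mem_icc.2 ⟨h, hi.2⟩, rfl⟩))

/-- Two subsets of `N` of the same cardinality are exchanged by a permutation supported on `N`. -/
theorem exists_perm_image_eq {ι : Type*} [DecidableEq ι] {N A B : Finset ι} (hA : A ⊆ N) (hB : B ⊆ N)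
    (h : A.card = B.card) :
    ∃ π : Equiv.Perm ι, (∀ i, π i ∈ N ↔ i ∈ N) ∧ (∀ i ∉ N, π i = i) ∧ A.image π = B := by
  have hcard : Fintype.card {x : N // (x : ι) ∈ A} = Fintype.card {x : N // (x : ι) ∈ B} := by
    have aux : ∀ {E : Finset ι}, E ⊆ N → Fintype.card {x : N // (x : ι) ∈ E} = E.card := by
      intro E hE
      rw [← Fintype.card_coe E]
      exact Fintype.card_congr
        ⟨fun x => ⟨x.1.1, x.2⟩, fun x => ⟨⟨x.1, hE x.2⟩, x.2⟩, fun _ => rfl, fun _ => rfl⟩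
    rw [aux hA, aux hB, h]
  let e := Fintype.equivOfCardEq hcard
  let σ : Equiv.Perm N := e.extendSubtype
  have hmaps : ∀ i ∈ A, Equiv.Perm.ofSubtype σ i ∈ B := by
    intro i hi
    rw [Equiv.Perm.ofSubtype_apply_of_mem (p := (· ∈ N)) σ (hA hi)]
    exact e.extendSubtype_mem ⟨i, hA hi⟩ hi
  refine ⟨Equiv.Perm.ofSubtype σ, fun i => Equiv.Perm.ofSubtype_apply_mem_iff_mem σ i,
    fun i hi => Equiv.Perm.ofSubtype_apply_of_not_mem σ hi, ?_⟩
  refine Finset.eq_of_subset_of_card_le (Finset.image_subset_iff.2 hmaps) ?_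
  rw [Finset.card_image_of_injective _ (Equiv.injective _), h]

/-- In a symmetrical code, the joint entropy of `S_{A → j}` with data that does not involve the
nodes of `N ⊇ A` depends on `A` only through its cardinality. -/
theorem Code.Symmetrical.HL_Sto_eq {C : Code Ω V d} (hsym : C.Symmetrical) {N : Finset ℕ}
    (hN : N ⊆ Finset.Icc 1 (d + 1)) {j : ℕ} (hj : j ∉ N) {D : List Atom}
    (hD : ∀ π : Equiv.Perm ℕ, (∀ i ∉ N, π i = i) → D.map (Atom.perm π) = D)
    {A B : List ℕ} (hA : A.toFinset ⊆ N) (hB : B.toFinset ⊆ N)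
    (h : A.toFinset.card = B.toFinset.card) :
    C.HL (Sto A j ++ D) = C.HL (Sto B j ++ D) := by
  obtain ⟨π, hπN, hπ, hAB⟩ := exists_perm_image_eq hA hB h
  have hmem : ∀ i ∈ Finset.Icc 1 (d + 1), π i ∈ Finset.Icc 1 (d + 1) := by
    intro i hi
    by_cases hiN : i ∈ N
    · exact hN ((hπN i).2 hiN)
    · rwa [hπ i hiN]
  rw [← hsym π hmem, List.map_append, hD π hπ]
  refine C.HL_congr fun a => ?_
  rw [List.mem_append, List.mem_append]
  refine or_congr_left ?_
  have hBmem : ∀ x, x ∈ B ↔ ∃ i ∈ A, π i = x := by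
    intro x
    rw [← List.mem_toFinset, ← hAB, Finset.mem_image]
    simp only [List.mem_toFinset]
  simp only [Sto, List.map_map, List.mem_map, hBmem, Function.comp_apply, Atom.perm, hπ j hj]
  constructor
  · rintro ⟨i, hi, rfl⟩
    exact ⟨π i, ⟨i, hi, rfl⟩, rfl⟩
  · rintro ⟨_, ⟨i, hi, rfl⟩, rfl⟩
    exact ⟨i, hi, rfl⟩

/-- Han's inequality for the repair data downloaded by node `s` from nodes with larger index. -/
theorem Code.Symmetrical.han_Sto {C : Code Ω V d} (hsym : C.Symmetrical) {s : ℕ}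
    {D : List Atom}
    (hD : ∀ π : Equiv.Perm ℕ, (∀ i ∉ Finset.Icc (s + 1) (d + 1), π i = i) →
      D.map (Atom.perm π) = D)
    {τ : Finset ℕ} (hτ : τ ⊆ Finset.Icc (s + 1) (d + 1)) (hτ₀ : 1 ≤ τ.card) :
    (τ.card : ℝ) * C.CH (SbarTo d s) D ≤
      ((d + 1 - s : ℕ) : ℝ) * C.CH (Sto (τ.sort (· ≤ ·)) s) D := by
  have hN : Finset.Icc (s + 1) (d + 1) ⊆ Finset.Icc 1 (d + 1) :=
    Finset.Icc_subset_Icc (by omega) le_rfl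
  have hs : s ∉ Finset.Icc (s + 1) (d + 1) := by simp
  have hsub : ∀ k, k ≤ d + 1 - s →
      (icc (s + 1) (s + k)).toFinset ⊆ Finset.Icc (s + 1) (d + 1) := by
    intro k hk x hx
    rw [List.mem_toFinset, mem_icc] at hx
    rw [Finset.mem_Icc]
    omega
  have hτle : τ.card ≤ d + 1 - s := by
    have := Finset.card_le_card hτ
    rw [Nat.card_Icc] at this
    omega
  have hcard : ∀ k, (icc (s + 1) (s + k)).toFinset.card = k := by
    intro k
    rw [icc, List.toFinset_card_of_nodup List.nodup_range', List.length_range']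
    omega
  have hmono : ∀ {A B : List ℕ}, A ⊆ B → Sto A s ++ D ⊆ Sto B s ++ D := fun h =>
    List.append_subset.2 ⟨List.subset_append_of_subset_left _ (List.map_subset _ h),
      List.subset_append_right _ _⟩
  have hconc := mul_sub_le_mul_sub_of_concave (m := d + 1 - s) (r := τ.card)
    (g := fun k => C.HL (Sto (icc (s + 1) (s + k)) s ++ D)) (fun k hk => by
      have hswap : C.HL (Sto ((s + k + 2) :: icc (s + 1) (s + k)) s ++ D) =
          C.HL (Sto (icc (s + 1) (s + (k + 1))) s ++ D) := by
        refine hsym.HL_Sto_eq hN hs hD ?_ (hsub _ (by omega)) ?_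
        · rw [List.toFinset_cons, Finset.insert_subset_iff]
          exact ⟨Finset.mem_Icc.2 (by omega), hsub k (by omega)⟩
        · rw [List.toFinset_cons, Finset.card_insert_of_notMem, hcard, hcard]
          rw [List.mem_toFinset, mem_icc]
          omega
      have hsubmod := C.HL_submodular
        (X := Sto (icc (s + 1) (s + (k + 1))) s ++ D)
        (Y := Sto ((s + k + 2) :: icc (s + 1) (s + k)) s ++ D)
        (Z := Sto (icc (s + 1) (s + k)) s ++ D)
        (W := Sto (icc (s + 1) (s + (k + 2))) s ++ D)
        (C.determinedBy_of_subset (hmono fun x hx => by rw [mem_icc] at hx ⊢; omega))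
        (C.determinedBy_of_subset (hmono (List.subset_cons_self _ _)))
        (by
          intro a ha
          rcases List.mem_append.1 ha with ha | ha
          · obtain ⟨i, hi, rfl⟩ := mem_Sto.1 ha
            rw [mem_icc] at hi
            by_cases hik : i ≤ s + (k + 1)
            · exact List.mem_append_left _ (List.mem_append_left _
                (mem_Sto.2 ⟨i, mem_icc.2 ⟨hi.1, hik⟩, rfl⟩))
            · refine List.mem_append_right _ (List.mem_append_left _ (mem_Sto.2 ⟨i, ?_, rfl⟩))
              exact List.mem_cons.2 (Or.inl (by omega))
          · exact List.mem_append_left _ (List.mem_append_right _ ha))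
      rw [hswap] at hsubmod
      linarith) hτ₀ hτle
  have hzero : C.HL (Sto (icc (s + 1) (s + 0)) s ++ D) = C.HL D := by
    simp [icc, Sto]
  have hfull : C.HL (Sto (icc (s + 1) (s + (d + 1 - s))) s ++ D) = C.HL (SbarTo d s ++ D) := by
    rw [SbarTo, Nat.add_sub_cancel' (by omega : s ≤ d + 1)]
  have hsort : C.HL (Sto (icc (s + 1) (s + τ.card)) s ++ D) =
      C.HL (Sto (τ.sort (· ≤ ·)) s ++ D) := by
    refine hsym.HL_Sto_eq hN hs hD (hsub _ hτle) ?_ ?_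
    · rwa [Finset.sort_toFinset]
    · rw [Finset.sort_toFinset, hcard]
  simp only [hzero, hfull, hsort] at hconc
  exact hconc

end Code

theorem statement17 {Ω V : Type} [Fintype Ω] {d : ℕ} (hd : 2 ≤ d)
    (C : Code Ω V d) (hsym : C.Symmetrical) (hregen : C.NodeRegen)
    {ℓ ℓ₁ r : ℕ} (hℓ : ℓ ∈ Finset.Icc 1 (d - 1)) (hℓ₁ : ℓ₁ ∈ Finset.Icc 0 (ℓ / 2))
    (hr : r ∈ Finset.Icc 1 (d - ℓ))
    (τ : Finset ℕ) (hτ : τ ⊆ Finset.Icc (ℓ + 2) (d + 1)) (hcard : τ.card = r) :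
    C.CH (Sto (τ.sort (· ≤ ·)) (ℓ + 1))
        (Ws (icc (ℓ₁ + 1) (2 * ℓ₁)) ++ Sfrom (ℓ + 1) (icc (ℓ₁ + 1) (2 * ℓ₁)) ++ Mup ℓ)
      ≥ (r : ℝ) / ((d : ℝ) - (ℓ : ℝ))
          * (C.CH (U d ℓ₁ (ℓ + 1)) (Mup ℓ) - C.CH (U d ℓ₁ ℓ) (Mup ℓ)) := by
  rw [Finset.mem_Icc] at hℓ hℓ₁ hr
  subst hcard
  set D := Ws (icc (ℓ₁ + 1) (2 * ℓ₁)) ++ Sfrom (ℓ + 1) (icc (ℓ₁ + 1) (2 * ℓ₁)) ++ Mup ℓ with hDdef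
  have hD : ∀ π : Equiv.Perm ℕ, (∀ i ∉ Finset.Icc (ℓ + 1 + 1) (d + 1), π i = i) →
      D.map (Atom.perm π) = D := by
    intro π hπ
    have hfix : ∀ i ≤ ℓ + 1, π i = i := fun i hi =>
      hπ i fun h => by rw [Finset.mem_Icc] at h; omega
    conv_rhs => rw [← List.map_id D]
    refine List.map_congr_left fun a ha => ?_
    simp only [hDdef, List.mem_append, mem_Ws, mem_Sfrom, mem_Mup, mem_icc] at ha
    rcases ha with (⟨i, hi, rfl⟩ | ⟨i, hi, rfl⟩) | ⟨i, hi, rfl⟩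
    · simp [Atom.perm, hfix i (by omega)]
    · simp [Atom.perm, hfix i (by omega), hfix (ℓ + 1) le_rfl]
    · rfl
  have hhan := hsym.han_Sto (s := ℓ + 1) hD hτ hr.1
  have hDU : DeterminedBy (C.rv D) (C.rv (U d ℓ₁ ℓ ++ Mup ℓ)) := by
    intro ω ω' e
    have eU := C.determinedBy_of_subset (List.subset_append_left _ _) _ _ e
    rw [C.rv_eq_rv_iff] at e ⊢
    intro a ha
    rw [hDdef, List.mem_append, List.mem_append] at ha
    rcases ha with (ha | ha) | ha
    · obtain ⟨i, hi, rfl⟩ := mem_Ws.1 ha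
      rw [mem_icc] at hi
      exact C.W_determinedBy_U hregen (t := ℓ₁) (s := ℓ) (by omega) (by omega) (by omega) _ _ eU
    · obtain ⟨j, hj, rfl⟩ := mem_Sfrom.1 ha
      rw [mem_icc] at hj
      exact e _ (List.mem_append_left _ (List.mem_append_right _ (mem_SbarToL.2
        ⟨j, mem_icc.2 (by omega), ℓ + 1, mem_icc.2 (by omega), rfl⟩)))
    · exact e a (List.mem_append_right _ ha)
  have hsubmod := C.HL_submodular (X := SbarTo d (ℓ + 1) ++ D) (Y := U d ℓ₁ ℓ ++ Mup ℓ) (Z := D)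
    (W := U d ℓ₁ (ℓ + 1) ++ Mup ℓ)
    (C.determinedBy_of_subset (List.subset_append_right _ _)) hDU (by
      intro a ha
      rw [U, List.mem_append, List.mem_append] at ha
      rcases ha with (ha | ha) | ha
      · exact List.mem_append_right _ (List.mem_append_left _ (List.mem_append_left _ ha))
      · obtain ⟨j, hj, i, hi, rfl⟩ := mem_SbarToL.1 ha
        rw [mem_icc] at hj
        by_cases hjℓ : j ≤ ℓ
        · exact List.mem_append_right _ (List.mem_append_left _ (List.mem_append_right _
            (mem_SbarToL.2 ⟨j, mem_icc.2 ⟨hj.1, hjℓ⟩, i, hi, rfl⟩)))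
        · obtain rfl : j = ℓ + 1 := by omega
          exact List.mem_append_left _ (List.mem_append_left _ (mem_Sto.2 ⟨i, hi, rfl⟩))
      · exact List.mem_append_right _ (List.mem_append_right _ ha))
  have hcast : ((d + 1 - (ℓ + 1) : ℕ) : ℝ) = (d : ℝ) - ℓ := by
    rw [Nat.add_sub_add_right, Nat.cast_sub (by omega)]
  have hpos : (0 : ℝ) < (d : ℝ) - ℓ := by
    rw [sub_pos]
    exact_mod_cast (by omega : ℓ < d)
  have hcond : C.CH (U d ℓ₁ (ℓ + 1)) (Mup ℓ) - C.CH (U d ℓ₁ ℓ) (Mup ℓ) ≤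
      C.CH (SbarTo d (ℓ + 1)) D := by
    simp only [Code.CH]
    linarith
  rw [hcast] at hhan
  rw [ge_iff_le, div_mul_eq_mul_div, div_le_iff₀ hpos, mul_comm (C.CH _ _)]
  exact (mul_le_mul_of_nonneg_left hcond (Nat.cast_nonneg _)).trans hhan

end

end MDCSR
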